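/- Fix positive integers k and t ≥ 2, and let θ^t map a graph G on [n] to the t-hypergraph whose hyperedges are the t-sets {x₁,...,x_t} of distinct vertices such that the number of common neighbors of x₁,...,x_t in G is odd. Then Pr over G ~ G(n,1/2) that θ^t(G) fails the hypergraph extension axioms EA^t_k is negligible in n. -/

import Mathlib

open Classical

/-- Adjacency in the graph on `Fin n` encoded by `g`. -/
def GAdj {n : ℕ} (g : Fin n → Fin n → Bool) (a b : Fin n) : Prop :=
  (a < b ∧ g a b = true) ∨ (b < a ∧ g b a = true)

/-- The transduced hypergraph `θ^t(G)` (a `t`-set is a hyperedge iff its number of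
common neighbors in `G` is odd) satisfies the hypergraph extension axioms `EA^t_k`:
for every `k`-set `S` and every family `T` of `(t-1)`-subsets of `S`, there is `v ∉ S`
such that each `(t-1)`-subset `e` of `S` forms a hyperedge `e ∪ {v}` of `θ^t(G)`
iff `e ∈ T`. -/
def ThetaHypEA (k t : ℕ) {n : ℕ} (g : Fin n → Fin n → Bool) : Prop :=
  ∀ S : Finset (Fin n), S.card = k →
    ∀ T ⊆ S.powersetCard (t - 1), ∃ v, v ∉ S ∧
      ∀ e ∈ S.powersetCard (t - 1),
        (Odd ((Finset.univ.filter (fun w : Fin n =>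
            ∀ u ∈ insert v e, GAdj g w u)).card) ↔ e ∈ T)

/-- All of the `v ∈ V` are bad. -/
def AllBad {Ω ι : Type} (good : ι → Ω → Prop) (V : Finset ι) (g : Ω) : Prop :=
  ∀ v ∈ V, ¬ good v g

/-- Abstract sequential exposure bound. -/
theorem exposure_bound {Ω ι : Type} [Fintype Ω] (M : ℕ) (hM : 0 < M)
    (R : ι → Ω → Ω → Prop) (good : ι → Ω → Prop) (V : Finset ι)
    (h1 : ∀ v ∈ V, ∀ v' ∈ V, v ≠ v' → ∀ g g', R v' g g' → (good v g ↔ good v g'))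
    (h2 : ∀ v ∈ V, ∀ g, ∃ g', R v g g' ∧ good v g')
    (h3 : ∀ v ∈ V, ∀ g', (Finset.univ.filter (fun g => R v g g')).card ≤ M) :
    ((Finset.univ.filter (AllBad good V)).card : ℝ)
      ≤ (1 - 1 / (M : ℝ)) ^ V.card * (Fintype.card Ω : ℝ) := by
  have hM1 : (1 : ℝ) ≤ M := by exact_mod_cast hM
  have hq : 0 ≤ 1 - 1 / (M : ℝ) := by
    rw [sub_nonneg, div_le_one (by linarith)]; exact hM1
  induction V using Finset.induction_on with
  | empty => simpa using Finset.card_le_univ _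
  | insert v V hv ih =>
    have ih' := ih (fun a ha b hb => h1 a (Finset.mem_insert_of_mem ha) b (Finset.mem_insert_of_mem hb))
      (fun a ha => h2 a (Finset.mem_insert_of_mem ha))
      (fun a ha => h3 a (Finset.mem_insert_of_mem ha))
    set F := Finset.univ.filter (AllBad good V) with hF
    have hvm := Finset.mem_insert_self v V
    choose φ hφ1 hφ2 using h2 v hvm
    have hsplit : (F.filter (fun g => good v g)).card
        + (F.filter (fun g => ¬ good v g)).card = F.card :=
      Finset.card_filter_add_card_filter_not _
    have heq : Finset.univ.filter (AllBad good (insert v V))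
        = F.filter (fun g => ¬ good v g) := by
      ext g
      simp only [hF, AllBad, Finset.mem_filter, Finset.mem_univ, true_and, Finset.forall_mem_insert]
      tauto
    have hmaps : ∀ g ∈ F, φ g ∈ F.filter (fun g => good v g) := by
      intro g hg
      simp only [hF, AllBad, Finset.mem_filter, Finset.mem_univ, true_and] at hg ⊢
      refine ⟨fun u hu hgood => hg u hu ?_, hφ2 g⟩
      exact (h1 u (Finset.mem_insert_of_mem hu) v hvm (fun h => hv (h ▸ hu)) g (φ g) (hφ1 g)).2 hgood
    have hle : F.card ≤ M * (F.filter (fun g => good v g)).card := by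
      refine Finset.card_le_mul_card_image_of_maps_to (f := φ) hmaps M ?_
      intro b _
      refine le_trans (Finset.card_le_card ?_) (h3 v hvm b)
      intro g hg
      simp only [Finset.mem_filter, Finset.mem_univ, true_and] at hg ⊢
      rw [← hg.2]; exact hφ1 g
    rw [heq, Finset.card_insert_of_notMem hv, pow_succ]
    have hs : ((F.filter (fun g => good v g)).card : ℝ)
        + ((F.filter (fun g => ¬ good v g)).card : ℝ) = F.card := by exact_mod_cast hsplit
    have hl : (F.card : ℝ) ≤ M * ((F.filter (fun g => good v g)).card : ℝ) := by exact_mod_cast hle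
    have hl' : (F.card : ℝ) / M ≤ ((F.filter (fun g => good v g)).card : ℝ) := by
      rw [div_le_iff₀ (by linarith)]; linarith
    calc ((F.filter (fun g => ¬ good v g)).card : ℝ) ≤ (1 - 1 / (M : ℝ)) * F.card := by
          have : (1 - 1 / (M : ℝ)) * F.card = F.card - F.card / M := by ring
          linarith
      _ ≤ (1 - 1 / (M : ℝ)) * ((1 - 1 / (M : ℝ)) ^ V.card * (Fintype.card Ω : ℝ)) :=
          mul_le_mul_of_nonneg_left ih' hq
      _ = _ := by ring

/-- Two encodings agree off the pairs between `v` and `X`. -/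
def AgreeOff {n : ℕ} (X : Finset (Fin n)) (v : Fin n) (g g' : Fin n → Fin n → Bool) : Prop :=
  ∀ a b, ¬ ((a = v ∧ b ∈ X) ∨ (b = v ∧ a ∈ X)) → g a b = g' a b

theorem AgreeOff.adj {n : ℕ} {X : Finset (Fin n)} {v : Fin n} {g g' : Fin n → Fin n → Bool}
    (h : AgreeOff X v g g') {a b : Fin n} (hab : ¬ ((a = v ∧ b ∈ X) ∨ (b = v ∧ a ∈ X))) :
    GAdj g a b ↔ GAdj g' a b := by
  unfold GAdj
  rw [h a b hab, h b a (by tauto)]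

theorem gadj_symm {n : ℕ} (g : Fin n → Fin n → Bool) (a b : Fin n) :
    GAdj g a b ↔ GAdj g b a := by
  unfold GAdj; tauto

theorem agreeOff_card {n : ℕ} (X : Finset (Fin n)) (v : Fin n) (g' : Fin n → Fin n → Bool) :
    (Finset.univ.filter (fun g => AgreeOff X v g g')).card ≤ 4 ^ X.card := by
  let ψ : (Fin n → Fin n → Bool) → (X → Bool) × (X → Bool) :=
    fun g => (fun x => g v x, fun x => g x v)
  have hc : (4 : ℕ) ^ X.card = (Finset.univ : Finset ((X → Bool) × (X → Bool))).card := by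
    simp [← mul_pow]
  rw [hc]
  apply Finset.card_le_card_of_injOn ψ (fun _ _ => Finset.mem_coe.2 (Finset.mem_univ _))
  intro g hg h hh hgh
  simp only [Finset.coe_filter, Finset.mem_univ, true_and, Set.mem_ofPred_eq] at hg hh
  have e1 := congrArg Prod.fst hgh
  have e2 := congrArg Prod.snd hgh
  funext a b
  by_cases c1 : a = v ∧ b ∈ X
  · obtain ⟨rfl, hb⟩ := c1
    exact congrFun e1 ⟨b, hb⟩
  by_cases c2 : b = v ∧ a ∈ X
  · obtain ⟨rfl, ha⟩ := c2
    exact congrFun e2 ⟨a, ha⟩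
  rw [hg a b (by tauto), hh a b (by tauto)]

theorem agreeOff_set {n : ℕ} (X : Finset (Fin n)) (v : Fin n) (hv : v ∉ X)
    (g : Fin n → Fin n → Bool) (σ : Fin n → Prop) :
    ∃ g', AgreeOff X v g g' ∧ ∀ x ∈ X, (GAdj g' v x ↔ σ x) := by
  refine ⟨fun a b => if a = v ∧ b ∈ X then decide (σ b) else
    if b = v ∧ a ∈ X then decide (σ a) else g a b, ?_, ?_⟩
  · intro a b hab
    rw [not_or] at hab
    simp only [if_neg hab.1, if_neg hab.2]
  · intro x hx
    have hne : v ≠ x := fun h => hv (h ▸ hx)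
    unfold GAdj
    rcases lt_or_gt_of_ne hne with h | h
    · simp [hx, h, h.not_gt]
    · simp [hx, h, h.not_gt, hv]

theorem bad_one {n : ℕ} (M : ℕ) (S e : Finset (Fin n)) (hM : 4 ^ S.card ≤ M) :
    ((Finset.univ.filter (AllBad (fun v (g : Fin n → Fin n → Bool) =>
        ∀ s ∈ S, (GAdj g v s ↔ s ∈ e)) (Finset.univ \ S))).card : ℝ)
      ≤ (1 - 1 / (M : ℝ)) ^ (Finset.univ \ S).card
        * (Fintype.card (Fin n → Fin n → Bool) : ℝ) := by
  apply exposure_bound M (lt_of_lt_of_le (by positivity) hM) (AgreeOff S)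
    (fun v g => ∀ s ∈ S, (GAdj g v s ↔ s ∈ e))
  · intro v hv v' hv' hne g g' h
    simp only [Finset.mem_sdiff, Finset.mem_univ, true_and] at hv hv'
    refine forall₂_congr fun s hs => ?_
    rw [h.adj]
    rintro (⟨rfl, _⟩ | ⟨rfl, _⟩)
    · exact hne rfl
    · exact hv' hs
  · intro v hv g
    simp only [Finset.mem_sdiff, Finset.mem_univ, true_and] at hv
    exact agreeOff_set S v hv g (fun s => s ∈ e)
  · intro v _ g'
    exact (agreeOff_card S v g').trans hM

/-- Common neighbourhood of `insert v e`. -/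
noncomputable def CN {n : ℕ} (g : Fin n → Fin n → Bool) (v : Fin n) (e : Finset (Fin n)) : Finset (Fin n) :=
  Finset.univ.filter (fun w : Fin n => ∀ u ∈ insert v e, GAdj g w u)

theorem bad_two {n : ℕ} (M r : ℕ) (S : Finset (Fin n)) (T : Finset (Finset (Fin n)))
    (w : ↥(S.powersetCard r) → Fin n) (hw : ∀ e, w e ∉ S)
    (hM : 4 ^ (S.powersetCard r).card ≤ M) :
    ((Finset.univ.filter (AllBad (fun v (g : Fin n → Fin n → Bool) =>
          ((∀ e, ∀ s ∈ S, (GAdj g (w e) s ↔ s ∈ e.1)) →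
            ∀ e : ↥(S.powersetCard r), (Odd (CN g v e.1).card ↔ e.1 ∈ T)))
        (Finset.univ \ (S ∪ Finset.univ.image w)))).card : ℝ)
      ≤ (1 - 1 / (M : ℝ)) ^ (Finset.univ \ (S ∪ Finset.univ.image w)).card
        * (Fintype.card (Fin n → Fin n → Bool) : ℝ) := by
  have hWc : (Finset.univ.image w).card ≤ (S.powersetCard r).card := by
    refine Finset.card_image_le.trans ?_
    simp
  have hWS : ∀ x ∈ Finset.univ.image w, x ∉ S := by
    intro x hx
    obtain ⟨e, _, rfl⟩ := Finset.mem_image.1 hx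
    exact hw e
  have hwW : ∀ e, w e ∈ Finset.univ.image w := fun e => Finset.mem_image_of_mem w (Finset.mem_univ e)
  generalize hWdef : Finset.univ.image w = W at *
  apply exposure_bound M (lt_of_lt_of_le (by positivity) hM) (AgreeOff W)
    (fun v g => (∀ e, ∀ s ∈ S, (GAdj g (w e) s ↔ s ∈ e.1)) →
            ∀ e : ↥(S.powersetCard r), (Odd (CN g v e.1).card ↔ e.1 ∈ T))
  · intro v hv v' hv' hne g g' h
    simp only [Finset.mem_sdiff, Finset.mem_univ, true_and, Finset.mem_union, not_or] at hv hv'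
    have a1 : (∀ e, ∀ s ∈ S, (GAdj g (w e) s ↔ s ∈ e.1)) ↔
        (∀ e, ∀ s ∈ S, (GAdj g' (w e) s ↔ s ∈ e.1)) := by
      refine forall_congr' fun e => forall₂_congr fun s hs => ?_
      rw [h.adj]
      rintro (⟨h1, _⟩ | ⟨rfl, _⟩)
      · exact hv'.2 (h1 ▸ hwW e)
      · exact hv'.1 hs
    have a2 : ∀ e : ↥(S.powersetCard r), CN g v e.1 = CN g' v e.1 := by
      intro e
      have heS := (Finset.mem_powersetCard.1 e.2).1
      unfold CN
      refine Finset.filter_congr fun x _ => forall₂_congr fun u hu => ?_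
      apply h.adj
      rcases Finset.mem_insert.1 hu with rfl | hu
      · rintro (⟨_, h1⟩ | ⟨h1, _⟩)
        · exact hv.2 h1
        · exact hne h1
      · rintro (⟨_, h1⟩ | ⟨rfl, _⟩)
        · exact hWS u h1 (heS hu)
        · exact hv'.1 (heS hu)
    simp only [a1, a2]
  · intro v hv g
    simp only [Finset.mem_sdiff, Finset.mem_univ, true_and, Finset.mem_union, not_or] at hv
    obtain ⟨g', hg', hσ⟩ := agreeOff_set W v hv.2 g
      (fun x => ∃ e, x = w e ∧ ¬ (Odd ((CN g v e.1).erase (w e)).card ↔ e.1 ∈ T))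
    refine ⟨g', hg', ?_⟩
    intro hwit e
    have hinj : ∀ e e' : ↥(S.powersetCard r), e.1 ⊆ e'.1 → e = e' := by
      intro e e' hs
      apply Subtype.ext
      apply Finset.eq_of_subset_of_card_le hs
      rw [(Finset.mem_powersetCard.1 e.2).2, (Finset.mem_powersetCard.1 e'.2).2]
    have hSW : ∀ x, ∀ s ∈ S, (GAdj g x s ↔ GAdj g' x s) := by
      intro x s hs
      apply hg'.adj
      rintro (⟨_, h1⟩ | ⟨rfl, _⟩)
      · exact hWS s h1 hs
      · exact hv.1 hs
    have hwinj : ∀ e e', w e = w e' → e = e' := by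
      intro e e' h
      apply hinj
      intro s hs
      have hsS := (Finset.mem_powersetCard.1 e.2).1 hs
      rw [← hwit e' s hsS, ← h, hwit e s hsS]; exact hs
    have heS := (Finset.mem_powersetCard.1 e.2).1
    have herase : (CN g' v e.1).erase (w e) = (CN g v e.1).erase (w e) := by
      ext x
      simp only [CN, Finset.mem_erase, Finset.mem_filter, Finset.mem_univ, true_and,
        Finset.forall_mem_insert]
      refine and_congr_right fun hx => ?_
      have b1 : (∀ u ∈ e.1, GAdj g' x u) ↔ ∀ u ∈ e.1, GAdj g x u :=
        forall₂_congr fun u hu => (hSW x u (heS hu)).symm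
      rw [b1]
      refine and_congr_left fun hall => ?_
      rw [hg'.adj]
      rintro (⟨_, h1⟩ | ⟨_, h1⟩)
      · exact hv.2 h1
      · rw [← hWdef] at h1
        obtain ⟨e', _, rfl⟩ := Finset.mem_image.1 h1
        apply hx
        rw [hinj e e']
        intro s hs
        rw [← hwit e' s (heS hs), ← hSW _ s (heS hs)]
        exact hall s hs
    have hmem : w e ∈ CN g' v e.1 ↔ ¬ (Odd ((CN g v e.1).erase (w e)).card ↔ e.1 ∈ T) := by
      have b0 : w e ∈ CN g' v e.1 ↔ GAdj g' (w e) v ∧ ∀ u ∈ e.1, GAdj g' (w e) u := by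
        simp only [CN, Finset.mem_filter, Finset.mem_univ, true_and,
          Finset.forall_mem_insert]
      have b2 : ∀ u ∈ e.1, GAdj g' (w e) u := fun u hu => (hwit e u (heS hu)).2 hu
      rw [b0, and_iff_left b2, gadj_symm, hσ _ (hwW e)]
      constructor
      · rintro ⟨e', h1, h2⟩
        obtain rfl := hwinj _ _ h1
        exact h2
      · intro h
        exact ⟨e, rfl, h⟩
    rw [← herase] at hmem
    by_cases hm : w e ∈ CN g' v e.1
    · have h1 := hmem.1 hm
      have h2 := Finset.card_erase_add_one hm
      rw [← h2, Nat.odd_add_one]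
      tauto
    · have h1 := mt hmem.2 hm
      rw [not_not, Finset.erase_eq_of_notMem hm] at h1
      exact h1
  · intro v _ g'
    exact (agreeOff_card W v g').trans
      ((Nat.pow_le_pow_right (by norm_num) hWc).trans hM)

/-- failure for a fixed pair `S, T` -/
def FailST {n : ℕ} (r : ℕ) (S : Finset (Fin n)) (T : Finset (Finset (Fin n)))
    (g : Fin n → Fin n → Bool) : Prop :=
  ¬ ∃ v, v ∉ S ∧ ∀ e ∈ S.powersetCard r, (Odd (CN g v e).card ↔ e ∈ T)

theorem fail_card {n : ℕ} (k r : ℕ) (S : Finset (Fin n)) (hS : S.card = k)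
    (T : Finset (Finset (Fin n))) (M : ℕ) (hM : M = 4 ^ (2 ^ k)) (hn : 0 < n) :
    ((Finset.univ.filter (FailST r S T)).card : ℝ) ≤
      ((2 : ℝ) ^ k + (n : ℝ) ^ (2 ^ k)) * ((1 - 1 / (M : ℝ)) ^ (n - (k + 2 ^ k))
        * (Fintype.card (Fin n → Fin n → Bool) : ℝ)) := by
  have hM1 : (1 : ℝ) ≤ M := by
    rw [hM]; exact_mod_cast Nat.one_le_pow _ _ (by norm_num)
  have hq : 0 ≤ 1 - 1 / (M : ℝ) := by
    rw [sub_nonneg, div_le_one (by linarith)]; exact hM1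
  have hq1 : 1 - 1 / (M : ℝ) ≤ 1 := by
    have : 0 ≤ 1 / (M : ℝ) := by positivity
    linarith
  set B := (1 - 1 / (M : ℝ)) ^ (n - (k + 2 ^ k))
        * (Fintype.card (Fin n → Fin n → Bool) : ℝ) with hB
  have hB0 : 0 ≤ B := by positivity
  have hPc : (S.powersetCard r).card ≤ 2 ^ k := by
    rw [Finset.card_powersetCard, hS]; exact Nat.choose_le_two_pow k r
  have key : ∀ X : Finset (Fin n), X.card ≤ k + 2 ^ k →
      (1 - 1 / (M : ℝ)) ^ (Finset.univ \ X).card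
        * (Fintype.card (Fin n → Fin n → Bool) : ℝ) ≤ B := by
    intro X hX
    refine mul_le_mul_of_nonneg_right ?_ (by positivity)
    apply pow_le_pow_of_le_one hq hq1
    rw [Finset.card_sdiff_of_subset (Finset.subset_univ _), Finset.card_univ, Fintype.card_fin]
    omega
  let B1 : Finset (Fin n) → Finset (Fin n → Fin n → Bool) := fun e =>
    Finset.univ.filter (AllBad (fun v (g : Fin n → Fin n → Bool) =>
        ∀ s ∈ S, (GAdj g v s ↔ s ∈ e)) (Finset.univ \ S))
  let B2 : (↥(S.powersetCard r) → Fin n) → Finset (Fin n → Fin n → Bool) := fun w =>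
    Finset.univ.filter (AllBad (fun v (g : Fin n → Fin n → Bool) =>
          ((∀ e, ∀ s ∈ S, (GAdj g (w e) s ↔ s ∈ e.1)) →
            ∀ e : ↥(S.powersetCard r), (Odd (CN g v e.1).card ↔ e.1 ∈ T)))
        (Finset.univ \ (S ∪ Finset.univ.image w)))
  let Ws := Finset.univ.filter (fun w : ↥(S.powersetCard r) → Fin n => ∀ e, w e ∉ S)
  have hsub : Finset.univ.filter (FailST r S T) ⊆
      ((S.powersetCard r).biUnion B1) ∪ Ws.biUnion B2 := by
    intro g hg
    have hg := (Finset.mem_filter.1 hg).2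
    rw [Finset.mem_union]
    by_cases hc : ∀ e ∈ S.powersetCard r, ∃ v, v ∉ S ∧ ∀ s ∈ S, (GAdj g v s ↔ s ∈ e)
    · right
      have hc' : ∀ e : ↥(S.powersetCard r), ∃ v, v ∉ S ∧ ∀ s ∈ S, (GAdj g v s ↔ s ∈ e.1) :=
        fun e => hc e.1 e.2
      choose w hw1 hw2 using hc'
      rw [Finset.mem_biUnion]
      refine ⟨w, Finset.mem_filter.2 ⟨Finset.mem_univ _, hw1⟩, Finset.mem_filter.2 ⟨Finset.mem_univ _, ?_⟩⟩
      intro v hv h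
      apply hg
      simp only [Finset.mem_sdiff, Finset.mem_univ, true_and, Finset.mem_union, not_or] at hv
      exact ⟨v, hv.1, fun e he => h hw2 ⟨e, he⟩⟩
    · left
      push Not at hc
      obtain ⟨e, he, h⟩ := hc
      rw [Finset.mem_biUnion]
      refine ⟨e, he, Finset.mem_filter.2 ⟨Finset.mem_univ _, ?_⟩⟩
      intro v hv hall
      obtain ⟨s, hs, h'⟩ := h v (Finset.mem_sdiff.1 hv).2
      have := hall s hs
      tauto
  have c1 : ∀ e ∈ S.powersetCard r, ((B1 e).card : ℝ) ≤ B := by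
    intro e _
    refine (bad_one M S e ?_).trans (key S (by omega))
    rw [hM, hS]
    exact Nat.pow_le_pow_right (by norm_num) Nat.lt_two_pow_self.le
  have c2 : ∀ w ∈ Ws, ((B2 w).card : ℝ) ≤ B := by
    intro w hw
    refine (bad_two M r S T w (Finset.mem_filter.1 hw).2 ?_).trans (key _ ?_)
    · rw [hM]
      exact Nat.pow_le_pow_right (by norm_num) hPc
    · refine (Finset.card_union_le _ _).trans ?_
      have : (Finset.univ.image w).card ≤ (S.powersetCard r).card := by
        refine Finset.card_image_le.trans ?_
        simp
      omega
  have hWsc : (Ws.card : ℝ) ≤ (n : ℝ) ^ (2 ^ k) := by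
    have : Ws.card ≤ n ^ (2 ^ k) := by
      refine (Finset.card_le_univ _).trans ?_
      rw [Fintype.card_fun, Fintype.card_fin, Fintype.card_coe]
      exact Nat.pow_le_pow_right hn hPc
    exact_mod_cast this
  have hPc' : ((S.powersetCard r).card : ℝ) ≤ 2 ^ k := by exact_mod_cast hPc
  calc ((Finset.univ.filter (FailST r S T)).card : ℝ)
      ≤ ((((S.powersetCard r).biUnion B1) ∪ Ws.biUnion B2).card : ℝ) := by
        exact_mod_cast Finset.card_le_card hsub
    _ ≤ (((S.powersetCard r).biUnion B1).card : ℝ) + ((Ws.biUnion B2).card : ℝ) := by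
        exact_mod_cast Finset.card_union_le _ _
    _ ≤ (∑ e ∈ S.powersetCard r, ((B1 e).card : ℝ)) + ∑ w ∈ Ws, ((B2 w).card : ℝ) := by
        refine add_le_add ?_ ?_
        · exact_mod_cast Finset.card_biUnion_le
        · exact_mod_cast Finset.card_biUnion_le
    _ ≤ (S.powersetCard r).card • B + Ws.card • B :=
        add_le_add (Finset.sum_le_card_nsmul _ _ _ c1) (Finset.sum_le_card_nsmul _ _ _ c2)
    _ ≤ _ := by
        rw [nsmul_eq_mul, nsmul_eq_mul, ← add_mul]
        exact mul_le_mul_of_nonneg_right (add_le_add hPc' hWsc) hB0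

theorem total_fail {n : ℕ} (k t : ℕ) (M : ℕ) (hM : M = 4 ^ (2 ^ k)) (hn : 0 < n) :
    ((Finset.univ.filter
          (fun g : Fin n → Fin n → Bool => ¬ ThetaHypEA k t g)).card : ℝ) ≤
      (n : ℝ) ^ k * (2 ^ (2 ^ k) * (((2 : ℝ) ^ k + (n : ℝ) ^ (2 ^ k)) *
        ((1 - 1 / (M : ℝ)) ^ (n - (k + 2 ^ k))
        * (Fintype.card (Fin n → Fin n → Bool) : ℝ)))) := by
  have hM1 : (1 : ℝ) ≤ M := by
    rw [hM]; exact_mod_cast Nat.one_le_pow _ _ (by norm_num)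
  have hq : 0 ≤ 1 - 1 / (M : ℝ) := by
    rw [sub_nonneg, div_le_one (by linarith)]; exact hM1
  have hf := fun S hS T => fail_card (n := n) k (t - 1) S hS T M hM hn
  set B := ((2 : ℝ) ^ k + (n : ℝ) ^ (2 ^ k)) *
        ((1 - 1 / (M : ℝ)) ^ (n - (k + 2 ^ k))
        * (Fintype.card (Fin n → Fin n → Bool) : ℝ)) with hB
  have hB0 : 0 ≤ B := by positivity
  let U : Finset (Finset (Fin n)) := Finset.univ.powersetCard k
  let P : Finset (Fin n) → Finset (Finset (Finset (Fin n))) :=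
    fun S => (S.powersetCard (t - 1)).powerset
  let D : Finset (Fin n) → Finset (Fin n → Fin n → Bool) := fun S =>
    (P S).biUnion (fun T => Finset.univ.filter (FailST (t - 1) S T))
  have hsub : Finset.univ.filter (fun g : Fin n → Fin n → Bool => ¬ ThetaHypEA k t g) ⊆
      U.biUnion D := by
    intro g hg
    have hg := (Finset.mem_filter.1 hg).2
    unfold ThetaHypEA at hg
    rw [not_forall] at hg
    obtain ⟨S, hg⟩ := hg
    rw [Classical.not_imp] at hg
    obtain ⟨hS, hg⟩ := hg
    rw [not_forall] at hg
    obtain ⟨T, hg⟩ := hg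
    rw [Classical.not_imp] at hg
    obtain ⟨hT, hg⟩ := hg
    refine Finset.mem_biUnion.2 ⟨S, Finset.mem_powersetCard.2 ⟨Finset.subset_univ _, hS⟩,
      Finset.mem_biUnion.2 ⟨T, Finset.mem_powerset.2 hT,
        Finset.mem_filter.2 ⟨Finset.mem_univ _, hg⟩⟩⟩
  have hD : ∀ S ∈ U, ((D S).card : ℝ) ≤ 2 ^ (2 ^ k) * B := by
    intro S hS
    have hS := (Finset.mem_powersetCard.1 hS).2
    have hPc : (P S).card ≤ 2 ^ (2 ^ k) := by
      simp only [P, Finset.card_powerset, Finset.card_powersetCard, hS]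
      exact Nat.pow_le_pow_right (by norm_num) (Nat.choose_le_two_pow k (t - 1))
    calc ((D S).card : ℝ)
        ≤ ∑ T ∈ P S, ((Finset.univ.filter (FailST (t - 1) S T)).card : ℝ) := by
          exact_mod_cast Finset.card_biUnion_le
      _ ≤ (P S).card • B := Finset.sum_le_card_nsmul _ _ _ (fun T _ => hf S hS T)
      _ ≤ _ := by
          rw [nsmul_eq_mul]
          refine mul_le_mul_of_nonneg_right ?_ hB0
          exact_mod_cast hPc
  have hUc : (U.card : ℝ) ≤ (n : ℝ) ^ k := by
    have : U.card ≤ n ^ k := by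
      simp only [U, Finset.card_powersetCard, Finset.card_univ, Fintype.card_fin]
      exact Nat.choose_le_pow n k
    exact_mod_cast this
  calc _ ≤ ((U.biUnion D).card : ℝ) := by exact_mod_cast Finset.card_le_card hsub
    _ ≤ ∑ S ∈ U, ((D S).card : ℝ) := by exact_mod_cast Finset.card_biUnion_le
    _ ≤ U.card • (2 ^ (2 ^ k) * B) := Finset.sum_le_card_nsmul _ _ _ hD
    _ ≤ _ := by
        rw [nsmul_eq_mul]
        exact mul_le_mul_of_nonneg_right hUc (by positivity)

/-- For fixed `k ≥ 1` and `t ≥ 2`, the probability over `G ~ G(n,1/2)` that `θ^t(G)`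
fails the hypergraph extension axioms `EA^t_k` is negligible in `n`. -/
theorem theta_transduction_extension_axioms (k t : ℕ) (hk : 0 < k) (ht : 2 ≤ t) :
    ∀ c : ℕ, ∃ N : ℕ, ∀ n ≥ N,
      ((Finset.univ.filter
          (fun g : Fin n → Fin n → Bool => ¬ ThetaHypEA k t g)).card : ℝ) /
        (Fintype.card (Fin n → Fin n → Bool) : ℝ) ≤ 1 / (n : ℝ) ^ c := by
  intro c
  obtain ⟨M, hM⟩ : ∃ M : ℕ, M = 4 ^ (2 ^ k) := ⟨_, rfl⟩
  have hM1 : (1 : ℝ) < M := by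
    rw [hM]; exact_mod_cast Nat.one_lt_pow (by positivity) (by norm_num)
  set q : ℝ := 1 - 1 / (M : ℝ) with hqdef
  have hq : 0 < q := by
    rw [hqdef, sub_pos, div_lt_one (by linarith)]; exact hM1
  have hq1 : q < 1 := by
    have : 0 < 1 / (M : ℝ) := by positivity
    linarith
  set K := k + 2 ^ k with hK
  set C : ℝ := 2 ^ (2 ^ k) * (2 ^ k + 1) / q ^ K with hC
  have hlim : Filter.Tendsto (fun n : ℕ => C * ((n : ℝ) ^ (c + k + 2 ^ k) * q ^ n))
      Filter.atTop (nhds (C * 0)) :=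
    (tendsto_pow_const_mul_const_pow_of_abs_lt_one _ (by rwa [abs_of_pos hq])).const_mul C
  rw [mul_zero] at hlim
  obtain ⟨N, hN⟩ := Filter.eventually_atTop.1 (hlim.eventually (gt_mem_nhds (zero_lt_one' ℝ)))
  refine ⟨max N (K + 1), fun n hn => ?_⟩
  have hnN := hN n (le_trans (le_max_left _ _) hn)
  have hnK : K + 1 ≤ n := le_trans (le_max_right _ _) hn
  have hn0 : 0 < n := lt_of_lt_of_le (Nat.succ_pos _) hnK
  have hnr : (1 : ℝ) ≤ n := by exact_mod_cast hn0
  have htot := total_fail (n := n) k t M hM hn0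
  have hcard : (0 : ℝ) < (Fintype.card (Fin n → Fin n → Bool) : ℝ) := by
    exact_mod_cast Fintype.card_pos
  rw [div_le_div_iff₀ hcard (by positivity), one_mul]
  have hqn : q ^ (n - K) = q ^ n / q ^ K := by
    rw [eq_div_iff (by positivity), ← pow_add, Nat.sub_add_cancel (le_trans (Nat.le_succ _) hnK)]
  have hpn : (1 : ℝ) ≤ (n : ℝ) ^ (2 ^ k) := one_le_pow₀ hnr
  have hsum : (2 : ℝ) ^ k + (n : ℝ) ^ (2 ^ k) ≤ (2 ^ k + 1) * (n : ℝ) ^ (2 ^ k) := by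
    have : (0 : ℝ) < 2 ^ k := by positivity
    nlinarith
  rw [← hqdef, ← hK, hqn] at htot
  set F := (Fintype.card (Fin n → Fin n → Bool) : ℝ)
  calc _ ≤ ((n : ℝ) ^ k * (2 ^ (2 ^ k) * (((2 : ℝ) ^ k + (n : ℝ) ^ (2 ^ k)) *
        (q ^ n / q ^ K * F)))) * (n : ℝ) ^ c := mul_le_mul_of_nonneg_right htot (by positivity)
    _ ≤ ((n : ℝ) ^ k * (2 ^ (2 ^ k) * (((2 ^ k + 1) * (n : ℝ) ^ (2 ^ k)) *
        (q ^ n / q ^ K * F)))) * (n : ℝ) ^ c := by gcongr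
    _ = (C * ((n : ℝ) ^ (c + k + 2 ^ k) * q ^ n)) * F := by
        rw [hC, pow_add, pow_add]; ring
    _ ≤ 1 * F := mul_le_mul_of_nonneg_right hnN.le hcard.le
    _ = F := one_mul F
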